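/- arXiv:1107.5898 — 2 statements merged into one kernel-verified Lean document; each statement's English description precedes it below -/
import Mathlib

section
/- For all complex numbers s, z, μ, ν and all positive integers m, k with m ≥ k, the generalized powers on the q-linear lattice satisfy [x_μ(s) − x_μ(z)]^{(m)} = q^{k(μ−ν)/2} · [x_ν(s) − x_ν(z)]^{(k)} · [x_μ(s) − x_μ(z−k)]^{(m−k)} (equivalently, the quotient [x_μ(s)−x_μ(z)]^{(m)} / [x_ν(s)−x_ν(z)]^{(k)} equals q^{k(μ−ν)/2}·[x_μ(s) − x_μ(z−k)]^{(m−k)} whenever the denominator is nonzero). -/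
noncomputable section

/-- `q^w := exp(w · log q)` for a complex exponent `w`. -/
def qp (q : ℝ) (w : ℂ) : ℂ := Complex.exp (w * (Real.log q : ℂ))

/-- Generalized power `[x_k(s) − x_k(z)]^{(n)}` on the q-linear lattice
`x(s) = c₁·q^s + c₂`. -/
def gp (q : ℝ) (c₁ : ℂ) (n : ℕ) (k s z : ℂ) : ℂ :=
  (-1 : ℂ)^n * c₁^n * qp q (-((n*(n-1) : ℕ) : ℂ)/2) * qp q ((n : ℂ) * (z + k/2)) *
    ∏ j ∈ Finset.range n, (1 - qp q (s - z + (j : ℂ)))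

theorem qp_add (q : ℝ) (a b : ℂ) : qp q (a + b) = qp q a * qp q b := by
  simp only [qp, add_mul, Complex.exp_add]

theorem natCast_mul_pred (n : ℕ) : ((n * (n - 1) : ℕ) : ℂ) = (n : ℂ) * ((n : ℂ) - 1) := by
  cases n <;> simp

theorem stmt2 (q : ℝ) (hq : 0 < q) (hq1 : q ≠ 1) (c₁ c₂ : ℂ) (hc₁ : c₁ ≠ 0)
    (s z μ ν : ℂ) (m k : ℕ) (hk : 0 < k) (hmk : k ≤ m) :
    gp q c₁ m μ s z =
      qp q ((k : ℂ) * (μ - ν) / 2) * gp q c₁ k ν s z *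
        gp q c₁ (m - k) μ s (z - (k : ℂ)) := by
  obtain ⟨l, rfl⟩ := Nat.exists_eq_add_of_le hmk
  have hprod : ∏ j ∈ Finset.range (k + l), (1 - qp q (s - z + (j : ℂ))) =
      (∏ j ∈ Finset.range k, (1 - qp q (s - z + (j : ℂ)))) *
        ∏ j ∈ Finset.range l, (1 - qp q (s - (z - (k : ℂ)) + (j : ℂ))) := by
    rw [Finset.prod_range_add]
    congr 1
    refine Finset.prod_congr rfl fun j _ => ?_
    congr 2
    push_cast
    ring
  have hqp : qp q (-(((k + l) * (k + l - 1) : ℕ) : ℂ) / 2) *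
        qp q (((k + l : ℕ) : ℂ) * (z + μ / 2)) =
      qp q ((k : ℂ) * (μ - ν) / 2) *
        (qp q (-((k * (k - 1) : ℕ) : ℂ) / 2) * qp q ((k : ℂ) * (z + ν / 2))) *
        (qp q (-((l * (l - 1) : ℕ) : ℂ) / 2) * qp q ((l : ℂ) * (z - (k : ℂ) + μ / 2))) := by
    simp only [← qp_add, natCast_mul_pred]
    congr 1
    push_cast
    ring
  rw [Nat.add_sub_cancel_left]
  unfold gp
  rw [hprod, mul_assoc _ (qp q _) (qp q _), hqp, pow_add, pow_add]
  ring
end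
end

section
/- For all complex numbers s, z, μ and every nonnegative integer m, the generalized powers on the q-linear lattice satisfy [x_μ(s) − x_μ(z)]^{(m+1)} = [x_{μ−1}(s+1) − x_{μ−1}(z)]^{(m)} · (x_{μ−m}(s) − x_{μ−m}(z)) (equivalently, the quotient [x_μ(s)−x_μ(z)]^{(m+1)} / [x_{μ−1}(s+1)−x_{μ−1}(z)]^{(m)} equals x_{μ−m}(s) − x_{μ−m}(z) whenever the denominator is nonzero). -/
noncomputable section

/-- The shifted q-linear lattice `x_k(s) = c₁·q^{s+k/2} + c₂`. -/
def latt (q : ℝ) (c₁ c₂ : ℂ) (k s : ℂ) : ℂ := c₁ * qp q (s + k/2) + c₂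

theorem cast_mul_pred (m : ℕ) : ((m * (m - 1) : ℕ) : ℂ) = (m : ℂ) * ((m : ℂ) - 1) := by
  cases m <;> simp

theorem latt_sub_latt (q : ℝ) (c₁ c₂ k s z : ℂ) :
    latt q c₁ c₂ k s - latt q c₁ c₂ k z = -c₁ * qp q (z + k / 2) * (1 - qp q (s - z)) := by
  have h : qp q (s + k / 2) = qp q (z + k / 2) * qp q (s - z) := by
    rw [← qp_add]; congr 1; ring
  rw [latt, latt, h]; ring

theorem qp_prefactor_succ (q : ℝ) (z μ : ℂ) (m : ℕ) :
    qp q (-(((m + 1) * (m + 1 - 1) : ℕ) : ℂ) / 2) * qp q (((m + 1 : ℕ) : ℂ) * (z + μ / 2)) =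
      qp q (-((m * (m - 1) : ℕ) : ℂ) / 2) * qp q ((m : ℂ) * (z + (μ - 1) / 2)) *
        qp q (z + (μ - m) / 2) := by
  rw [← qp_add, ← qp_add, ← qp_add, cast_mul_pred, cast_mul_pred]
  congr 1
  push_cast
  ring

theorem prod_one_sub_qp_succ (q : ℝ) (s z : ℂ) (m : ℕ) :
    ∏ j ∈ Finset.range (m + 1), (1 - qp q (s - z + (j : ℂ))) =
      (∏ j ∈ Finset.range m, (1 - qp q (s + 1 - z + (j : ℂ)))) * (1 - qp q (s - z)) := by
  rw [Finset.prod_range_succ', Nat.cast_zero, add_zero]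
  congr 1
  refine Finset.prod_congr rfl fun j _ => ?_
  congr 2
  push_cast
  ring

theorem stmt3 (q : ℝ) (hq : 0 < q) (hq1 : q ≠ 1) (c₁ c₂ : ℂ) (hc₁ : c₁ ≠ 0)
    (s z μ : ℂ) (m : ℕ) :
    gp q c₁ (m + 1) μ s z =
      gp q c₁ m (μ - 1) (s + 1) z *
        (latt q c₁ c₂ (μ - (m : ℂ)) s - latt q c₁ c₂ (μ - (m : ℂ)) z) := by
  rw [latt_sub_latt, gp, gp, prod_one_sub_qp_succ,
    mul_assoc ((-1 : ℂ) ^ (m + 1) * c₁ ^ (m + 1)), qp_prefactor_succ]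
  ring
end
end
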